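/- Assume η ∈ P(b,ε) and ε ≥ 0 elementwise. Then the negated value of the maximum-entropy program equals an ℓ1-regularized multi-class logistic regression objective: − inf_{z ∈ P(b,ε)} z·log z = inf_{θ ∈ ℝ^m} [ −η·log g^{(θ)} + Σ_{j=1}^m ( (b*_j − (b_j − ε_j))·θ_j⁺ + ((b_j + ε_j) − b*_j)·θ_j⁻ ) ], where θ_j⁺ = max(θ_j, 0) and θ_j⁻ = max(−θ_j, 0) are the positive and negative parts of θ_j. -/

import Mathlib

open Finset

attribute [local instance] Classical.propDecidable

noncomputable section

/-- The simplex `Δ_k^n`: rows are probability distributions over `Fin k`. -/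
def Simplex (n k : ℕ) : Set (Fin n → Fin k → ℝ) :=
  {z | (∀ i ℓ, 0 ≤ z i ℓ) ∧ ∀ i, ∑ ℓ, z i ℓ = 1}

/-- Number of points where rule `j` does not abstain. -/
def nRule {n k p : ℕ} (h : Fin p → Fin n → Option (Fin k)) (j : Fin p) : ℕ :=
  (Finset.univ.filter (fun i => h j i ≠ none)).card

/-- The constraint matrix `A`, with `m = p + k` rows indexed by `Fin p ⊕ Fin k`. -/
def Amat {n k p : ℕ} (h : Fin p → Fin n → Option (Fin k)) :
    Fin p ⊕ Fin k → Fin n → Fin k → ℝ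
  | Sum.inl j => fun i ℓ => if h j i = some ℓ then 1 / (nRule h j : ℝ) else 0
  | Sum.inr ℓ' => fun i ℓ => if ℓ = ℓ' then 1 / (n : ℝ) else 0

/-- `(A z)_j`. -/
def applyA {n k p : ℕ} (h : Fin p → Fin n → Option (Fin k))
    (z : Fin n → Fin k → ℝ) (j : Fin p ⊕ Fin k) : ℝ :=
  ∑ i, ∑ ℓ, Amat h j i ℓ * z i ℓ

/-- The polytope `P(b, ε)`. -/
def Polytope {n k p : ℕ} (h : Fin p → Fin n → Option (Fin k))
    (b ε : Fin p ⊕ Fin k → ℝ) : Set (Fin n → Fin k → ℝ) :=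
  {z | z ∈ Simplex n k ∧ ∀ j, b j - ε j ≤ applyA h z j ∧ applyA h z j ≤ b j + ε j}

/-- Extended-real logarithm, with `elog 0 = ⊥ = -∞`. -/
def elog (x : ℝ) : EReal := if x = 0 then ⊥ else ((Real.log x : ℝ) : EReal)

/-- `z · log g`, valued in `[-∞, 0]` with the convention `0 · log 0 = 0`. -/
def dotlog {n k : ℕ} (z g : Fin n → Fin k → ℝ) : EReal :=
  ∑ i, ∑ ℓ, (z i ℓ : EReal) * elog (g i ℓ)

/-- `a^{(θ)}_{iℓ} = Σ_j θ_j · A j i ℓ`. -/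
def avec {n k p : ℕ} (h : Fin p → Fin n → Option (Fin k))
    (θ : Fin p ⊕ Fin k → ℝ) (i : Fin n) (ℓ : Fin k) : ℝ :=
  ∑ j, θ j * Amat h j i ℓ

/-- The exponential-family (softmax) prediction `g^{(θ)}`. -/
def gexp {n k p : ℕ} (h : Fin p → Fin n → Option (Fin k))
    (θ : Fin p ⊕ Fin k → ℝ) (i : Fin n) (ℓ : Fin k) : ℝ :=
  Real.exp (avec h θ i ℓ) / ∑ ℓ', Real.exp (avec h θ i ℓ')

/-- The BF dual objective `(σ'−σ)·b − (σ'+σ)·ε − Σ_i log(Σ_ℓ exp(a^{(σ'−σ)}_{iℓ}))`. -/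
def dualObj {n k p : ℕ} (h : Fin p → Fin n → Option (Fin k))
    (b ε σ σ' : Fin p ⊕ Fin k → ℝ) : ℝ :=
  (∑ j, (σ' j - σ j) * b j) - (∑ j, (σ' j + σ j) * ε j)
    - ∑ i, Real.log (∑ ℓ, Real.exp (avec h (fun j => σ' j - σ j) i ℓ))

/-- KL summand `a·log(a/c)`, with `0·log(0/c) = 0` and `a·log(a/0) = ⊤` for `a ≠ 0`. -/
def klTerm (a c : ℝ) : EReal :=
  if a = 0 then 0 else if c = 0 then ⊤ else ((a * Real.log (a / c) : ℝ) : EReal)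

/-- `d(μ, ν)`, the summed KL divergences, valued in `[0, +∞]`. -/
def dKL {n k : ℕ} (μ ν : Fin n → Fin k → ℝ) : EReal :=
  ∑ i, ∑ ℓ, klTerm (μ i ℓ) (ν i ℓ)

/-- Unnormalized one-coin Dawid–Skene score `N_{iℓ}`. -/
def Nds {n k p : ℕ} (h : Fin p → Fin n → Option (Fin k))
    (w : Fin k → ℝ) (β : Fin p → ℝ) (i : Fin n) (ℓ : Fin k) : ℝ :=
  w ℓ * (∏ j ∈ Finset.univ.filter (fun j => h j i = some ℓ), β j)
    * ∏ j ∈ Finset.univ.filter (fun j => ∃ ℓ' ≠ ℓ, h j i = some ℓ'),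
        (1 - β j) / ((k : ℝ) - 1)

/-- The one-coin Dawid–Skene prediction `g^{ds}(w, β)`. -/
def gds {n k p : ℕ} (h : Fin p → Fin n → Option (Fin k))
    (w : Fin k → ℝ) (β : Fin p → ℝ) (i : Fin n) (ℓ : Fin k) : ℝ :=
  Nds h w β i ℓ / ∑ ℓ', Nds h w β i ℓ'

/-- The total Shannon entropy of the rows of `z`. -/
def entropy {n k : ℕ} (z : Fin n → Fin k → ℝ) : ℝ :=
  ∑ i, ∑ ℓ, Real.negMulLog (z i ℓ)

lemma continuous_entropy {n k : ℕ} : Continuous (entropy (n := n) (k := k)) := by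
  unfold entropy
  fun_prop

lemma dotlog_self {n k : ℕ} (z : Fin n → Fin k → ℝ) :
    dotlog z z = ((-entropy z : ℝ) : EReal) := by
  have hterm : ∀ x : ℝ, (x : EReal) * elog x = ((-Real.negMulLog x : ℝ) : EReal) := by
    intro x
    by_cases hx : x = 0
    · simp [hx]
    · rw [elog, if_neg hx, ← EReal.coe_mul]
      simp [Real.negMulLog]
  have hcoe : ∀ {m : ℕ} (f : Fin m → ℝ), ∑ i, ((f i : ℝ) : EReal) = ((∑ i, f i : ℝ) : EReal) :=
    fun f => (map_sum (⟨⟨fun x : ℝ => (x : EReal), EReal.coe_zero⟩, EReal.coe_add⟩ : ℝ →+ EReal)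
      f univ).symm
  simp only [dotlog, entropy, hterm, hcoe, sum_neg_distrib]

lemma convex_simplex (n k : ℕ) : Convex ℝ (Simplex n k) := by
  rintro x ⟨hx, hx'⟩ y ⟨hy, hy'⟩ s t hs ht hst
  refine ⟨fun i ℓ => ?_, fun i => ?_⟩
  · have := mul_nonneg hs (hx i ℓ)
    have := mul_nonneg ht (hy i ℓ)
    simp only [Pi.add_apply, Pi.smul_apply, smul_eq_mul]
    linarith
  · simp [sum_add_distrib, ← mul_sum, hx', hy', hst]

lemma isClosed_simplex (n k : ℕ) : IsClosed (Simplex n k) := by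
  have : Simplex n k = (⋂ i, ⋂ ℓ, {z | 0 ≤ z i ℓ}) ∩ ⋂ i, {z | ∑ ℓ, z i ℓ = 1} := by
    ext z; simp [Simplex]
  rw [this]
  refine (isClosed_iInter fun i => isClosed_iInter fun ℓ => ?_).inter (isClosed_iInter fun i => ?_)
  · exact isClosed_le (by fun_prop) (by fun_prop)
  · exact isClosed_eq (by fun_prop) (by fun_prop)

lemma isCompact_simplex (n k : ℕ) : IsCompact (Simplex n k) := by
  refine (isCompact_Icc (a := (0 : Fin n → Fin k → ℝ)) (b := 1)).of_isClosed_subset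
    (isClosed_simplex n k) fun z hz => ⟨fun i ℓ => hz.1 i ℓ, fun i ℓ => ?_⟩
  have := single_le_sum (f := z i) (fun ℓ _ => hz.1 i ℓ) (mem_univ ℓ)
  rwa [hz.2 i] at this

lemma concaveOn_entropy (n k : ℕ) : ConcaveOn ℝ (Simplex n k) entropy := by
  refine ⟨convex_simplex n k, fun x hx y hy s t hs ht hst => ?_⟩
  simp only [entropy, smul_eq_mul, mul_sum, ← sum_add_distrib]
  exact sum_le_sum fun i _ => sum_le_sum fun ℓ _ =>
    Real.concaveOn_negMulLog.2 (hx.1 i ℓ) (hy.1 i ℓ) hs ht hst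

/-- Gibbs' inequality. -/
lemma entropy_le_neg_sum_mul_log {n k : ℕ} {z g : Fin n → Fin k → ℝ} (hz : z ∈ Simplex n k)
    (hg : g ∈ Simplex n k) (hpos : ∀ i ℓ, 0 < g i ℓ) :
    entropy z ≤ -∑ i, ∑ ℓ, z i ℓ * Real.log (g i ℓ) := by
  have hterm : ∀ i ℓ, Real.negMulLog (z i ℓ) ≤ g i ℓ - z i ℓ - z i ℓ * Real.log (g i ℓ) := by
    intro i ℓ
    rcases (hz.1 i ℓ).eq_or_lt with h0 | h0
    · simp [← h0, (hpos i ℓ).le]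
    · have := mul_le_mul_of_nonneg_left (Real.log_le_sub_one_of_pos (div_pos (hpos i ℓ) h0)) h0.le
      rw [Real.log_div (hpos i ℓ).ne' h0.ne', mul_sub, mul_sub, mul_div_cancel₀ _ h0.ne'] at this
      rw [Real.negMulLog]
      linarith
  calc entropy z ≤ ∑ i, ∑ ℓ, (g i ℓ - z i ℓ - z i ℓ * Real.log (g i ℓ)) :=
        sum_le_sum fun i _ => sum_le_sum fun ℓ _ => hterm i ℓ
    _ = _ := by simp [sum_sub_distrib, hz.2, hg.2]

section

variable {n k p : ℕ} (h : Fin p → Fin n → Option (Fin k))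

lemma continuous_applyA (j : Fin p ⊕ Fin k) : Continuous fun z => applyA h z j := by
  unfold applyA
  fun_prop

lemma applyA_combo (x y : Fin n → Fin k → ℝ) (s t : ℝ) (j : Fin p ⊕ Fin k) :
    applyA h (s • x + t • y) j = s * applyA h x j + t * applyA h y j := by
  simp only [applyA, mul_sum, ← sum_add_distrib, Pi.add_apply, Pi.smul_apply, smul_eq_mul]
  exact sum_congr rfl fun i _ => sum_congr rfl fun ℓ _ => by ring

lemma sum_exp_pos (hk : 0 < k) (a : Fin k → ℝ) : 0 < ∑ ℓ, Real.exp (a ℓ) :=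
  sum_pos (fun _ _ => Real.exp_pos _) ⟨⟨0, hk⟩, mem_univ _⟩

lemma gexp_pos (hk : 0 < k) (θ : Fin p ⊕ Fin k → ℝ) (i : Fin n) (ℓ : Fin k) :
    0 < gexp h θ i ℓ :=
  div_pos (Real.exp_pos _) (sum_exp_pos hk _)

lemma gexp_mem_simplex (hk : 0 < k) (θ : Fin p ⊕ Fin k → ℝ) : gexp h θ ∈ Simplex n k := by
  refine ⟨fun i ℓ => (gexp_pos h hk θ i ℓ).le, fun i => ?_⟩
  simp only [gexp, ← sum_div]
  exact div_self (sum_exp_pos hk _).ne'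

lemma sum_mul_log_gexp (hk : 0 < k) (θ : Fin p ⊕ Fin k → ℝ) {y : Fin n → Fin k → ℝ}
    (hy : y ∈ Simplex n k) :
    ∑ i, ∑ ℓ, y i ℓ * Real.log (gexp h θ i ℓ)
      = ∑ j, θ j * applyA h y j - ∑ i, Real.log (∑ ℓ, Real.exp (avec h θ i ℓ)) := by
  have h1 : ∑ i, ∑ ℓ, y i ℓ * avec h θ i ℓ = ∑ j, θ j * applyA h y j := by
    simp only [avec, applyA, mul_sum]
    rw [sum_comm (s := (univ : Finset (Fin p ⊕ Fin k)))]
    refine sum_congr rfl fun i _ => ?_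
    rw [sum_comm]
    exact sum_congr rfl fun j _ => sum_congr rfl fun ℓ _ => by ring
  simp only [gexp, Real.log_div (Real.exp_ne_zero _) (sum_exp_pos hk _).ne', Real.log_exp,
    mul_sub, sum_sub_distrib, ← sum_mul, hy.2, one_mul, h1]

/-- The regularized regression objective does not depend on the reference labeling. -/
lemma regression_objective_eq (hk : 0 < k) (b ε θ : Fin p ⊕ Fin k → ℝ) {y : Fin n → Fin k → ℝ}
    (hy : y ∈ Simplex n k) :
    -(∑ i, ∑ ℓ, y i ℓ * Real.log (gexp h θ i ℓ))
        + ∑ j, ((applyA h y j - (b j - ε j)) * max (θ j) 0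
            + ((b j + ε j) - applyA h y j) * max (-θ j) 0)
      = ∑ i, Real.log (∑ ℓ, Real.exp (avec h θ i ℓ)) + ∑ j, (ε j * |θ j| - θ j * b j) := by
  have hj : ∀ j, (applyA h y j - (b j - ε j)) * max (θ j) 0
      + ((b j + ε j) - applyA h y j) * max (-θ j) 0
      = θ j * applyA h y j + (ε j * |θ j| - θ j * b j) := by
    intro j
    rcases le_total 0 (θ j) with h0 | h0
    · rw [max_eq_left h0, max_eq_right (by linarith), abs_of_nonneg h0]; ring
    · rw [max_eq_right h0, max_eq_left (by linarith), abs_of_nonpos h0]; ring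
  rw [sum_mul_log_gexp h hk θ hy]
  simp only [hj, sum_add_distrib]
  ring

lemma isCompact_polytope (b ε : Fin p ⊕ Fin k → ℝ) : IsCompact (Polytope h b ε) := by
  have : Polytope h b ε = Simplex n k ∩
      ⋂ j, {z | b j - ε j ≤ applyA h z j ∧ applyA h z j ≤ b j + ε j} := by
    ext z; simp [Polytope, -Sum.forall]
  rw [this]
  refine (isCompact_simplex n k).inter_right (isClosed_iInter fun j => ?_)
  exact (isClosed_le continuous_const (continuous_applyA h j)).inter
    (isClosed_le (continuous_applyA h j) continuous_const)

/-- The hypograph of the value of the entropy program as a function of a shift of `b`. -/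
def valueHypograph (b ε : Fin p ⊕ Fin k → ℝ) : Set ((Fin p ⊕ Fin k → ℝ) × ℝ) :=
  {q | ∃ z ∈ Simplex n k, (∀ j, |applyA h z j - b j - q.1 j| ≤ ε j) ∧ q.2 ≤ entropy z}

lemma convex_valueHypograph (b ε : Fin p ⊕ Fin k → ℝ) : Convex ℝ (valueHypograph h b ε) := by
  rintro q ⟨x, hx, hxb, hxe⟩ r ⟨y, hy, hyb, hye⟩ s t hs ht hst
  refine ⟨s • x + t • y, convex_simplex n k hx hy hs ht hst, fun j => ?_, ?_⟩
  · have e : applyA h (s • x + t • y) j - b j - (s • q + t • r).1 j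
        = s * (applyA h x j - b j - q.1 j) + t * (applyA h y j - b j - r.1 j) := by
      simp only [applyA_combo, Prod.fst_add, Prod.smul_fst, Pi.add_apply, Pi.smul_apply,
        smul_eq_mul]
      linear_combination b j * hst
    rw [e]
    calc _ ≤ s * |applyA h x j - b j - q.1 j| + t * |applyA h y j - b j - r.1 j| := by
          refine (abs_add_le _ _).trans_eq ?_
          rw [abs_mul, abs_mul, abs_of_nonneg hs, abs_of_nonneg ht]
      _ ≤ s * ε j + t * ε j := by gcongr; exacts [hxb j, hyb j]
      _ = ε j := by rw [← add_mul, hst, one_mul]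
  · refine le_trans ?_ ((concaveOn_entropy n k).2 hx hy hs ht hst)
    simp only [Prod.snd_add, Prod.smul_snd, smul_eq_mul]
    gcongr

lemma isClosed_valueHypograph (b ε : Fin p ⊕ Fin k → ℝ) : IsClosed (valueHypograph h b ε) := by
  have : CompactSpace (Simplex n k) := isCompact_iff_compactSpace.mp (isCompact_simplex n k)
  let S : Set (Simplex n k × ((Fin p ⊕ Fin k → ℝ) × ℝ)) :=
    (⋂ j, {x | |applyA h x.1 j - b j - x.2.1 j| ≤ ε j}) ∩ {x | x.2.2 ≤ entropy x.1.1}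
  have hS : IsClosed S := by
    refine (isClosed_iInter fun j => isClosed_le ?_ continuous_const).inter (isClosed_le ?_ ?_)
    · have := (continuous_applyA h j).comp (continuous_subtype_val.comp
        (continuous_fst (X := Simplex n k) (Y := (Fin p ⊕ Fin k → ℝ) × ℝ)))
      exact ((this.sub continuous_const).sub (by fun_prop)).abs
    · fun_prop
    · exact continuous_entropy.comp (continuous_subtype_val.comp continuous_fst)
  have e : valueHypograph h b ε = Prod.snd '' S := by
    ext q
    constructor
    · rintro ⟨z, hz, h1, h2⟩
      exact ⟨(⟨z, hz⟩, q), ⟨Set.mem_iInter.2 h1, h2⟩, rfl⟩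
    · rintro ⟨⟨z, q⟩, ⟨h1, h2⟩, rfl⟩
      exact ⟨z, z.2, Set.mem_iInter.1 h1, h2⟩
  rw [e]
  exact isClosedMap_snd_of_compactSpace S hS

lemma zero_mem_valueHypograph_iff (b ε : Fin p ⊕ Fin k → ℝ) (v : ℝ) :
    ((0, v) : (Fin p ⊕ Fin k → ℝ) × ℝ) ∈ valueHypograph h b ε
      ↔ ∃ z ∈ Polytope h b ε, v ≤ entropy z := by
  have hj : ∀ (z : Fin n → Fin k → ℝ) (j : Fin p ⊕ Fin k), |applyA h z j - b j| ≤ ε j ↔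
      b j - ε j ≤ applyA h z j ∧ applyA h z j ≤ b j + ε j := by
    intro z j
    rw [abs_le]
    constructor <;> rintro ⟨h1, h2⟩ <;> constructor <;> linarith
  simp only [valueHypograph, Polytope, Set.mem_ofPred_eq, Pi.zero_apply, sub_zero, hj, and_assoc]

/-- Strong duality: every strict upper bound of the entropy program exceeds a dual value. -/
lemma exists_dual_lt (hk : 0 < k) {b ε : Fin p ⊕ Fin k → ℝ} (hε : ∀ j, 0 ≤ ε j)
    {z₀ : Fin n → Fin k → ℝ} (hz₀ : z₀ ∈ Polytope h b ε) {v : ℝ}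
    (hv : ∀ z ∈ Polytope h b ε, entropy z < v) :
    ∃ θ : Fin p ⊕ Fin k → ℝ,
      ∑ i, Real.log (∑ ℓ, Real.exp (avec h θ i ℓ)) + ∑ j, (ε j * |θ j| - θ j * b j) < v := by
  have hnot : ((0, v) : (Fin p ⊕ Fin k → ℝ) × ℝ) ∉ valueHypograph h b ε := by
    rw [zero_mem_valueHypograph_iff]
    rintro ⟨z, hz, hvz⟩
    exact (hv z hz).not_ge hvz
  obtain ⟨f, u, hf, hu⟩ := geometric_hahn_banach_closed_point (convex_valueHypograph h b ε)
    (isClosed_valueHypograph h b ε) hnot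
  set s := f (0, 1) with hs
  set c : Fin p ⊕ Fin k → ℝ := fun j => f (Pi.single j 1, 0) with hc
  have hfe : ∀ q : (Fin p ⊕ Fin k → ℝ) × ℝ, f q = ∑ j, q.1 j * c j + q.2 * s := by
    intro q
    have hq : q = ∑ j, q.1 j • ((Pi.single j 1, 0) : (Fin p ⊕ Fin k → ℝ) × ℝ)
        + q.2 • ((0, 1) : (Fin p ⊕ Fin k → ℝ) × ℝ) := by
      refine Prod.ext (funext fun j => ?_) ?_
      · simp [Prod.fst_sum, Finset.sum_apply, Pi.single_apply, -Fintype.sum_sum_type]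
      · simp [Prod.snd_sum]
    conv_lhs => rw [hq]
    simp only [map_add, map_sum, map_smul, smul_eq_mul, hs, hc]
  have h0 := hf _ ((zero_mem_valueHypograph_iff h b ε (entropy z₀)).2 ⟨z₀, hz₀, le_rfl⟩)
  rw [hfe] at h0 hu
  simp only [Pi.zero_apply, zero_mul, sum_const_zero, zero_add] at h0 hu
  have hspos : 0 < s := by
    by_contra hneg
    nlinarith [hv z₀ hz₀]
  refine ⟨fun j => c j / s, ?_⟩
  set θ : Fin p ⊕ Fin k → ℝ := fun j => c j / s with hθ
  have hcθ : ∀ j, c j = θ j * s := fun j => (div_mul_cancel₀ _ hspos.ne').symm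
  have hg := gexp_mem_simplex (n := n) h hk θ
  let q : (Fin p ⊕ Fin k → ℝ) × ℝ :=
    (fun j => applyA h (gexp h θ) j - b j + ε j * SignType.sign (θ j), entropy (gexp h θ))
  have hq : q ∈ valueHypograph h b ε := by
    refine ⟨gexp h θ, hg, fun j => ?_, le_rfl⟩
    have : applyA h (gexp h θ) j - b j - q.1 j = -(ε j * SignType.sign (θ j)) := by
      simp only [q]; ring
    rw [this, abs_neg, abs_mul, abs_of_nonneg (hε j)]
    refine mul_le_of_le_one_right (hε j) ?_
    rcases SignType.sign (θ j) <;> simp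
  have h1 := (hf q hq).trans hu
  have hent : entropy (gexp h θ) = -∑ i, ∑ ℓ, gexp h θ i ℓ * Real.log (gexp h θ i ℓ) := by
    simp [entropy, Real.negMulLog, sum_neg_distrib]
  rw [hfe, show q.2 = _ from hent, sum_mul_log_gexp h hk θ hg] at h1
  have hsum : ∑ j, q.1 j * c j
      = (∑ j, θ j * applyA h (gexp h θ) j + ∑ j, (ε j * |θ j| - θ j * b j)) * s := by
    rw [← sum_add_distrib, sum_mul]
    refine sum_congr rfl fun j _ => ?_
    rw [hcθ, ← sign_mul_self]
    simp only [q]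
    ring
  rw [hsum, ← add_mul] at h1
  have := lt_of_mul_lt_mul_right h1 hspos.le
  linarith

/-- Weak duality. -/
lemma entropy_le_dual (hk : 0 < k) {b ε : Fin p ⊕ Fin k → ℝ} (θ : Fin p ⊕ Fin k → ℝ)
    {z : Fin n → Fin k → ℝ} (hz : z ∈ Polytope h b ε) :
    entropy z
      ≤ ∑ i, Real.log (∑ ℓ, Real.exp (avec h θ i ℓ)) + ∑ j, (ε j * |θ j| - θ j * b j) := by
  rw [← regression_objective_eq h hk b ε θ hz.1]
  refine (entropy_le_neg_sum_mul_log hz.1 (gexp_mem_simplex h hk θ) (gexp_pos h hk θ)).trans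
    (le_add_of_nonneg_right (sum_nonneg fun j _ => add_nonneg ?_ ?_))
  · exact mul_nonneg (sub_nonneg.2 (hz.2 j).1) (le_max_right _ _)
  · exact mul_nonneg (sub_nonneg.2 (hz.2 j).2) (le_max_right _ _)

end

/-- the negated max-entropy value equals an ℓ1-regularized
multi-class logistic regression objective. -/
theorem stmt3 {n k p : ℕ} (hn : 0 < n) (hk : 2 ≤ k) (hp : 0 < p)
    (h : Fin p → Fin n → Option (Fin k)) (hnj : ∀ j, 0 < nRule h j)
    (η : Fin n → Fin k → ℝ) (b ε : Fin p ⊕ Fin k → ℝ)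
    (hε : ∀ j, 0 ≤ ε j) (hmem : η ∈ Polytope h b ε) :
    -(⨅ z ∈ Polytope h b ε, dotlog z z)
      = ⨅ θ : Fin p ⊕ Fin k → ℝ,
          (((-(∑ i, ∑ ℓ, η i ℓ * Real.log (gexp h θ i ℓ)))
            + ∑ j, ((applyA h η j - (b j - ε j)) * max (θ j) 0
                + ((b j + ε j) - applyA h η j) * max (-θ j) 0) : ℝ) : EReal) := by
  have hk0 : 0 < k := by omega
  simp only [regression_objective_eq h hk0 b ε _ hmem.1, dotlog_self]
  apply le_antisymm
  · refine le_iInf fun θ => EReal.neg_le_of_neg_le (le_iInf₂ fun z hz => ?_)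
    rw [← EReal.coe_neg, EReal.coe_le_coe_iff]
    exact neg_le_neg (entropy_le_dual h hk0 θ hz)
  · obtain ⟨z₀, hz₀, hmax⟩ := (isCompact_polytope h b ε).exists_isMaxOn ⟨η, hmem⟩
      continuous_entropy.continuousOn
    have hle : ((entropy z₀ : ℝ) : EReal)
        ≤ -(⨅ z ∈ Polytope h b ε, ((-entropy z : ℝ) : EReal)) := by
      refine EReal.le_neg_of_le_neg ((iInf₂_le z₀ hz₀).trans_eq ?_)
      rw [EReal.coe_neg]
    refine le_trans (EReal.le_of_forall_lt_iff_le.1 fun v hv => ?_) hle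
    obtain ⟨θ, hθ⟩ := exists_dual_lt h hk0 hε hz₀ (v := v)
      fun z hz => (hmax hz).trans_lt (EReal.coe_lt_coe_iff.1 hv)
    exact (iInf_le _ θ).trans (EReal.coe_le_coe_iff.2 hθ.le)
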